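/- Let X_0 = (V_0, E_0) be a finite connected non-oriented graph, equip C_1(X_0, ℝ) with the inner product in which ⟨e_1, e_2⟩ = 1 if e_1 = e_2, = −1 if e_1 = ē_2, and = 0 otherwise, and let P : C_1(X_0, ℝ) → H_1(X_0, ℝ) be the orthogonal projection onto H_1(X_0, ℝ) = ker ∂. Then there exists a constant c > 0 such that Σ_{e∈E_0} (⟨P(e), x⟩)² = c·|x|² for all x ∈ H_1(X_0, ℝ); in fact, choosing a set E_0^o of oriented edges containing exactly one of each pair {e, ē}, one has Σ_{e∈E_0^o} (⟨P(e), x⟩)² = |x|², so the sum over all of E_0 equals 2|x|². Consequently the family {P(e)}_{e∈E_0} is a tight frame of H_1(X_0, ℝ), and the realization of the maximal abelian covering of X_0 defined by Φ(v) = P(π(e_1)) + ⋯ + P(π(e_n)) along a path from a fixed base vertex to v is a standard realization. -/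

import Mathlib

noncomputable section

variable {V E : Type}

/-- The chain in `C₁(X₀, ℝ)` associated to an edge `e` (value `1` at `e`, `−1` at `ē`),
realizing the relation `ē = −e` inside `ℝ^E`. -/
def chainOf [DecidableEq E] (bar : E → E) (e : E) : E → ℝ :=
  fun f => (if f = e then 1 else 0) - (if f = bar e then 1 else 0)

/-- The inner product on `C₁(X₀, ℝ)`: on chains of edges it satisfies
`⟨e₁, e₂⟩ = 1` if `e₁ = e₂`, `= −1` if `e₁ = ē₂`, and `= 0` otherwise. -/
def ip [Fintype E] (x y : E → ℝ) : ℝ := (1 / 2) * ∑ e, x e * y e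

/-- The boundary operator `∂ : C₁(X₀, ℝ) → C₀(X₀, ℝ)`. -/
def bd [Fintype E] [DecidableEq V] (o t : E → V) (x : E → ℝ) : V → ℝ :=
  fun v => ∑ e, x e * ((if t e = v then 1 else 0) - (if o e = v then 1 else 0))

/-- `C₁(X₀, ℝ)`, realized as the antisymmetric functions on oriented edges. -/
def C1 (bar : E → E) : Set (E → ℝ) := {x | ∀ e, x (bar e) = - x e}

/-- `H₁(X₀, ℝ) = ker ∂ ⊆ C₁(X₀, ℝ)`. -/
def H1 [Fintype E] [DecidableEq V] (o t : E → V) (bar : E → E) : Set (E → ℝ) :=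
  {x | x ∈ C1 bar ∧ bd o t x = 0}

/-- The chain of a path given as a list of edges. -/
def pathChain [DecidableEq E] (bar : E → E) (L : List E) : E → ℝ :=
  (L.map (chainOf bar)).sum

/-- The sum of the edges emanating from a vertex `v`. -/
def starChain [Fintype E] [DecidableEq E] [DecidableEq V] (o : E → V) (bar : E → E)
    (v : V) : E → ℝ :=
  ∑ e ∈ Finset.univ.filter (fun e => o e = v), chainOf bar e

/-- For a finite connected non-oriented graph `X₀` and the orthogonal
projection `P : C₁(X₀, ℝ) → H₁(X₀, ℝ)`: choosing a set `S` of oriented edges containing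
exactly one of each pair `{e, ē}`, one has `Σ_{e∈S} ⟨P(e), x⟩² = |x|²` for `x ∈ H₁`, hence
`Σ_{e∈E} ⟨P(e), x⟩² = 2|x|² = c|x|²` with `c = 2 > 0`; consequently `{P(e)}_{e∈E}` is a
tight frame of `H₁(X₀, ℝ)`, and the projected edge vectors satisfy the two conditions
(vanishing sum / balancing at every vertex, and the tight-frame condition) characterizing
the standard realization of the maximal abelian covering of `X₀` built from them. -/
theorem stmt12 [Fintype V] [Fintype E] [DecidableEq V] [DecidableEq E]
    (o t : E → V) (bar : E → E)
    (bar_bar : ∀ e, bar (bar e) = e)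
    (bar_ne : ∀ e, bar e ≠ e)
    (o_bar : ∀ e, o (bar e) = t e)
    (hconn : ∀ u v : V, ∃ L : List E,
      L.Chain' (fun e f => t e = o f) ∧
      ((L = [] ∧ u = v) ∨ ∃ hne : L ≠ [], o (L.head hne) = u ∧ t (L.getLast hne) = v))
    -- `P` is the orthogonal projection of `C₁(X₀, ℝ)` onto `H₁(X₀, ℝ)`
    (P : (E → ℝ) →ₗ[ℝ] (E → ℝ))
    (hPmem : ∀ x ∈ C1 bar, P x ∈ H1 o t bar)
    (hPid : ∀ h ∈ H1 o t bar, P h = h)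
    (hPorth : ∀ x ∈ C1 bar, ∀ h ∈ H1 o t bar, ip (x - P x) h = 0)
    -- `S` contains exactly one of each pair `{e, ē}` of oriented edges
    (S : Finset E) (hS : ∀ e : E, e ∈ S ↔ bar e ∉ S) :
    (∀ x ∈ H1 o t bar, ∑ e ∈ S, (ip (P (chainOf bar e)) x) ^ 2 = ip x x) ∧
    (∀ x ∈ H1 o t bar, ∑ e : E, (ip (P (chainOf bar e)) x) ^ 2 = 2 * ip x x) ∧
    (∃ c : ℝ, 0 < c ∧ ∀ x ∈ H1 o t bar,
      ∑ e : E, (ip (P (chainOf bar e)) x) ^ 2 = c * ip x x) ∧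
    -- `{P(e)}` is a tight frame of `H₁(X₀, ℝ)`
    (∃ c : ℝ, 0 < c ∧ ∀ x ∈ H1 o t bar,
      ∑ e : E, ip x (P (chainOf bar e)) • P (chainOf bar e) = c • x) ∧
    -- the conditions characterizing a standard realization hold for the vectors `P(e)`
    ((∑ e : E, P (chainOf bar e)) = 0 ∧
      ∀ v : V, ∑ e ∈ Finset.univ.filter (fun e => o e = v), P (chainOf bar e) = 0) := by
  have sum_bar : ∀ (M : Type) [AddCommMonoid M] (g : E → M), ∑ e, g (bar e) = ∑ e, g e := by
    intro M _ g
    exact Equiv.sum_comp (Function.Involutive.toPerm bar bar_bar) g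
  have t_bar : ∀ e, t (bar e) = o e := by
    intro e
    rw [← o_bar, bar_bar]
  have chain_bar : ∀ e, chainOf bar (bar e) = - chainOf bar e := by
    intro e
    funext f
    simp [chainOf, bar_bar]
  have bar_eq : ∀ e f, (bar f = e) ↔ (f = bar e) := by
    intro e f
    constructor
    · rintro rfl
      exact (bar_bar f).symm
    · rintro rfl
      exact bar_bar e
  have chain_mem : ∀ e, chainOf bar e ∈ C1 bar := by
    intro e f
    have h2 : (bar f = bar e) ↔ (f = e) := by rw [bar_eq, bar_bar]
    simp [chainOf, bar_eq, h2, bar_bar]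
  have ip_chain : ∀ e, ∀ x ∈ C1 bar, ip (chainOf bar e) x = x e := by
    intro e x hx
    have := hx e
    simp only [ip, chainOf, sub_mul, ite_mul, one_mul, zero_mul, Finset.sum_sub_distrib,
      Finset.sum_ite_eq', Finset.mem_univ, if_true]
    rw [this]
    ring
  have ip_sub : ∀ x y z : E → ℝ, ip (x - y) z = ip x z - ip y z := by
    intro x y z
    simp only [ip, Pi.sub_apply, sub_mul, Finset.sum_sub_distrib]
    ring
  have ip_symm : ∀ x y : E → ℝ, ip x y = ip y x := by
    intro x y
    simp only [ip, mul_comm]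
  have ipP : ∀ e, ∀ x ∈ H1 o t bar, ip (P (chainOf bar e)) x = x e := by
    intro e x hx
    have h := hPorth _ (chain_mem e) x hx
    rw [ip_sub, ip_chain e x hx.1] at h
    linarith
  have full : ∀ x ∈ H1 o t bar, ∑ e : E, (ip (P (chainOf bar e)) x) ^ 2 = 2 * ip x x := by
    intro x hx
    rw [Finset.sum_congr rfl (fun e _ => by rw [ipP e x hx])]
    simp only [ip, pow_two]
    ring
  have half : ∀ x ∈ H1 o t bar, ∑ e ∈ S, (ip (P (chainOf bar e)) x) ^ 2 = ip x x := by
    intro x hx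
    have h1 := full x hx
    have h2 : ∑ e ∈ Sᶜ, (ip (P (chainOf bar e)) x) ^ 2
        = ∑ e ∈ S, (ip (P (chainOf bar e)) x) ^ 2 := by
      refine Finset.sum_nbij' bar bar ?_ ?_ ?_ ?_ ?_
      · intro e he
        by_contra hc
        exact (Finset.mem_compl.1 he) ((hS e).2 hc)
      · intro e he
        exact Finset.mem_compl.2 ((hS e).1 he)
      · intro e _
        exact bar_bar e
      · intro e _
        exact bar_bar e
      · intro e _
        rw [ipP _ x hx, ipP _ x hx, hx.1 e]
        ring
    have h3 := Finset.sum_add_sum_compl S (fun e => (ip (P (chainOf bar e)) x) ^ 2)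
    linarith
  refine ⟨half, full, ⟨2, by norm_num, full⟩, ⟨2, by norm_num, ?_⟩, ?_, ?_⟩
  · intro x hx
    have h1 : ∑ e : E, x e • chainOf bar e = (2 : ℝ) • x := by
      funext f
      have hxf := hx.1 f
      have h2 : ∀ e, (f = bar e) ↔ (bar f = e) := fun e => (bar_eq e f).symm
      simp only [Finset.sum_apply, Pi.smul_apply, smul_eq_mul, chainOf, h2, mul_sub, mul_ite,
        mul_one, mul_zero, Finset.sum_sub_distrib, Finset.sum_ite_eq, Finset.mem_univ, if_true]
      rw [hxf]
      ring
    calc ∑ e : E, ip x (P (chainOf bar e)) • P (chainOf bar e)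
        = ∑ e : E, x e • P (chainOf bar e) := by
          refine Finset.sum_congr rfl (fun e _ => ?_)
          rw [ip_symm, ipP e x hx]
      _ = P (∑ e : E, x e • chainOf bar e) := by simp only [map_sum, map_smul]
      _ = (2 : ℝ) • x := by rw [h1, map_smul, hPid x hx]
  · have h := sum_bar _ (fun e => P (chainOf bar e))
    simp only [chain_bar, map_neg, Finset.sum_neg_distrib] at h
    exact self_eq_neg.1 h.symm
  · intro v
    rw [← map_sum]
    set s : E → ℝ := ∑ e ∈ Finset.univ.filter (fun e => o e = v), chainOf bar e with hs
    have hsC : s ∈ C1 bar := by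
      intro f
      simp only [hs, Finset.sum_apply]
      rw [← Finset.sum_neg_distrib]
      exact Finset.sum_congr rfl (fun e _ => chain_mem e f)
    have hh := hPmem s hsC
    have ipsum : ∀ h ∈ H1 o t bar, ip s h = 0 := by
      intro h hh
      have e1 : ip s h = ∑ e ∈ Finset.univ.filter (fun e => o e = v), ip (chainOf bar e) h := by
        simp only [ip, hs, Finset.sum_apply, Finset.sum_mul]
        rw [Finset.sum_comm, Finset.mul_sum]
      have e2 : ip s h = ∑ e, h e * (if o e = v then 1 else 0) := by
        rw [e1, Finset.sum_congr rfl (fun e _ => ip_chain e h hh.1), Finset.sum_filter]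
        simp
      have e3 := congrFun hh.2 v
      simp only [bd, mul_sub, Finset.sum_sub_distrib, Pi.zero_apply] at e3
      have e4 := sum_bar ℝ (fun e => h e * (if t e = v then 1 else 0))
      simp only [t_bar, hh.1 _, neg_mul, Finset.sum_neg_distrib] at e4
      linarith
    have h0 : ip (P s) (P s) = 0 := by
      have a := hPorth s hsC _ hh
      rw [ip_sub, ipsum _ hh] at a
      linarith
    have h1 : ∑ e, P s e * P s e = 0 := by
      simp only [ip] at h0
      linarith
    rw [Finset.sum_eq_zero_iff_of_nonneg (fun e _ => mul_self_nonneg _)] at h1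
    funext e
    exact mul_self_eq_zero.1 (h1 e (Finset.mem_univ e))
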